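/- Let (μ_n)_{n≥1} ⊂ 𝓜 converge weakly to μ ∈ 𝓜. Then for each j = 0, 1, 2, the functions ∂_x^j Φ_{μ_n} converge to ∂_x^j Φ_μ uniformly on [0,1]×ℝ as n → ∞. -/

import Mathlib

open MeasureTheory ProbabilityTheory Real Set Filter

noncomputable section

/-- `ξ(s) = ∑_{p≥2} β_p² s^p` (we use `β : ℕ → ℝ` with `β 0 = β 1 = 0`). -/
def xiFn (β : ℕ → ℝ) (s : ℝ) : ℝ := ∑' p : ℕ, β p ^ 2 * s ^ p

/-- `ξ'(s)`. -/
def xiD (β : ℕ → ℝ) (s : ℝ) : ℝ := ∑' p : ℕ, (p : ℝ) * β p ^ 2 * s ^ (p - 1)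

/-- `ζ(s) = ξ''(s)`. -/
def zetaFn (β : ℕ → ℝ) (s : ℝ) : ℝ :=
  ∑' p : ℕ, (p : ℝ) * ((p : ℝ) - 1) * β p ^ 2 * s ^ (p - 2)

/-- admissible sequence of temperature parameters -/
def ValidBeta (β : ℕ → ℝ) : Prop :=
  β 0 = 0 ∧ β 1 = 0 ∧ (∀ p, 0 ≤ β p) ∧ (∃ p, 2 ≤ p ∧ 0 < β p) ∧
    Summable fun p : ℕ => (2 : ℝ) ^ p * β p ^ 2

/-- membership in `𝓜`: a Borel probability measure concentrated on `[0,1]` -/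
def MemM (μ : Measure ℝ) : Prop := IsProbabilityMeasure μ ∧ μ (Icc (0 : ℝ) 1)ᶜ = 0

/-- member of `𝓜_d`: finitely supported -/
def FinSupp (μ : Measure ℝ) : Prop := ∃ S : Finset ℝ, μ ((S : Set ℝ))ᶜ = 0

/-- the distribution function `α(s) = μ([0,s])` -/
def distF (μ : Measure ℝ) (s : ℝ) : ℝ := (μ (Icc 0 s)).toReal

/-- the metric `d(μ,ν) = ∫_0^1 |μ([0,s]) - ν([0,s])| ds` -/
def dM (μ ν : Measure ℝ) : ℝ := ∫ s in (0 : ℝ)..1, |distF μ s - distF ν s|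

/-- the smallest atom of `μ` strictly after `s` (or `1` if there is none) -/
def nextPt (μ : Measure ℝ) (s : ℝ) : ℝ :=
  sInf ({q : ℝ | s < q ∧ q ≤ 1 ∧ μ {q} ≠ 0} ∪ {1})

/-- one step of the backward recursion defining the Parisi PDE solution:
`(1/m) log E exp (m Φ(t, x + z √(ξ'(t) - ξ'(s))))`, interpreted as
`E Φ(t, x + z √(ξ'(t) - ξ'(s)))` when `m = 0`. -/
def gStep (β : ℕ → ℝ) (Φ : ℝ → ℝ → ℝ) (m t s x : ℝ) : ℝ :=
  if m = 0 then ∫ z, Φ t (x + z * Real.sqrt (xiD β t - xiD β s)) ∂(gaussianReal 0 1)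
  else m⁻¹ * Real.log
    (∫ z, Real.exp (m * Φ t (x + z * Real.sqrt (xiD β t - xiD β s))) ∂(gaussianReal 0 1))

/-- `Φ` is the Parisi PDE solution of a finitely supported `μ`. -/
def IsAtomicSol (β : ℕ → ℝ) (μ : Measure ℝ) (Φ : ℝ → ℝ → ℝ) : Prop :=
  (∀ x : ℝ, Φ 1 x = Real.log (Real.cosh x)) ∧
  (∀ s ∈ Ico (0 : ℝ) 1, ∀ x : ℝ, Φ s x = gStep β Φ (distF μ s) (nextPt μ s) s x)

/-- `Φ` is the Parisi family `μ ↦ Φ_μ`: it satisfies the backward recursion on `𝓜_d`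
and is `d`-continuous on `𝓜` (uniformly in `(s,x) ∈ [0,1] × ℝ`). -/
def IsParisiFamily (β : ℕ → ℝ) (Φ : Measure ℝ → ℝ → ℝ → ℝ) : Prop :=
  (∀ μ, MemM μ → FinSupp μ → IsAtomicSol β μ (Φ μ)) ∧
  (∀ μ, MemM μ → ∀ ε : ℝ, 0 < ε → ∃ δ : ℝ, 0 < δ ∧ ∀ ν, MemM ν → dM μ ν < δ →
      ∀ s ∈ Icc (0 : ℝ) 1, ∀ x : ℝ, |Φ μ s x - Φ ν s x| < ε)

/-- `B` is a standard Brownian motion under `P`. -/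
def IsStdBM {Ω : Type*} [MeasurableSpace Ω] (P : Measure Ω) (B : ℝ → Ω → ℝ) : Prop :=
  (∀ t : ℝ, Measurable (B t)) ∧
  (∀ᵐ ω ∂P, B 0 ω = 0) ∧
  (∀ᵐ ω ∂P, Continuous fun t => B t ω) ∧
  (∀ s t : ℝ, 0 ≤ s → s ≤ t →
    Measure.map (fun ω => B t ω - B s ω) P = gaussianReal 0 (Real.toNNReal (t - s))) ∧
  (∀ s t : ℝ, 0 ≤ s → s ≤ t →
    Indep (MeasurableSpace.comap (fun ω => B t ω - B s ω) inferInstance)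
      (⨆ v ∈ Icc (0 : ℝ) s, MeasurableSpace.comap (B v) inferInstance) P)

/-- the space `𝓓[s,t]`: progressively measurable processes bounded by `1` on `[s,t]` -/
def InD {Ω : Type*} {mΩ : MeasurableSpace Ω} (𝓕 : Filtration ℝ mΩ) (s t : ℝ)
    (u : ℝ → Ω → ℝ) : Prop :=
  ProgMeasurable 𝓕 u ∧ ∀ r ∈ Icc s t, ∀ ω, |u r ω| ≤ 1

/-- the norm `‖u‖ = (E ∫_s^t u(r)² dr)^{1/2}` on `𝓓[s,t]` -/
def normD {Ω : Type*} [MeasurableSpace Ω] (P : Measure Ω) (s t : ℝ)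
    (u : ℝ → Ω → ℝ) : ℝ :=
  Real.sqrt (∫ ω, (∫ r in s..t, (u r ω) ^ 2) ∂P)

/-- the functional
`F^{s,t}(u,x) = E[Φ_μ(t, x + ∫_s^t α ζ u dr + W(t) - W(s)) - (1/2)∫_s^t α ζ u² dr]`,
where `W r = B (ξ' r)`. -/
def Ffn {Ω : Type*} [MeasurableSpace Ω] (P : Measure Ω) (β : ℕ → ℝ) (μ : Measure ℝ)
    (Φ : ℝ → ℝ → ℝ) (W : ℝ → Ω → ℝ) (s t : ℝ) (u : ℝ → Ω → ℝ) (x : ℝ) : ℝ :=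
  ∫ ω, (Φ t (x + (∫ r in s..t, distF μ r * zetaFn β r * u r ω) + (W t ω - W s ω))
      - (1 / 2) * ∫ r in s..t, distF μ r * zetaFn β r * (u r ω) ^ 2) ∂P


/-! ### Gaussian averaging -/

lemma hda {f g : ℝ → ℝ} {a b x : ℝ} (h : HasDerivAt f a x) (hf : ∀ y, g y = f y)
    (hab : b = a) : HasDerivAt g b x := by
  have : g = f := funext hf
  rw [this, hab]; exact h

/-- Gaussian averaging operator. -/
def gT (σ : ℝ) (F : ℝ → ℝ) (x : ℝ) : ℝ := ∫ z, F (x + z * σ) ∂(gaussianReal 0 1)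

lemma integrable_exp_abs_gauss (c : ℝ) :
    Integrable (fun z : ℝ => Real.exp (c * |z|)) (gaussianReal 0 1) := by
  apply integrable_exp_mul_abs
  · exact integrable_exp_mul_gaussianReal c
  · exact integrable_exp_mul_gaussianReal (-c)

lemma exp_shift_bound (σ x0 x z : ℝ) (hx : |x - x0| ≤ 1) :
    Real.exp |x + z * σ| ≤ Real.exp (|x0| + 1) * Real.exp (|σ| * |z|) := by
  rw [← Real.exp_add]
  apply Real.exp_le_exp.mpr
  have h1 : x + z * σ = (x - x0) + x0 + z * σ := by ring
  have h2 : |x + z * σ| ≤ |x - x0| + |x0| + |z * σ| := by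
    rw [h1]; exact (abs_add_le _ _).trans (by gcongr; exact abs_add_le _ _)
  rw [abs_mul] at h2
  nlinarith

lemma gT_integrable (σ : ℝ) {F : ℝ → ℝ} (hm : Measurable F) {A : ℝ}
    (hA : ∀ x, |F x| ≤ A * Real.exp |x|) (x : ℝ) :
    Integrable (fun z => F (x + z * σ)) (gaussianReal 0 1) := by
  have hA0 : 0 ≤ A := by
    have := (abs_nonneg _).trans (hA 0); simpa using this
  refine Integrable.mono' (((integrable_exp_abs_gauss |σ|).const_mul
    (A * Real.exp (|x| + 1)))) (hm.comp (by fun_prop)).aestronglyMeasurable ?_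
  refine Eventually.of_forall fun z => ?_
  have := exp_shift_bound σ x x z (by simp)
  rw [Real.norm_eq_abs, mul_assoc]
  exact (hA _).trans (by gcongr)

lemma gT_hasDerivAt (σ : ℝ) {F F' : ℝ → ℝ} (hF : ∀ x, HasDerivAt F (F' x) x) {A : ℝ}
    (hA : ∀ x, |F x| ≤ A * Real.exp |x|) (hA' : ∀ x, |F' x| ≤ A * Real.exp |x|) (x : ℝ) :
    HasDerivAt (gT σ F) (gT σ F' x) x := by
  have hA0 : 0 ≤ A := by
    have := (abs_nonneg _).trans (hA 0); simpa using this
  have hmF : Measurable F :=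
    (continuous_iff_continuousAt.mpr fun x => (hF x).continuousAt).measurable
  have hmF' : Measurable F' := by
    have : F' = deriv F := funext fun x => (hF x).deriv.symm
    rw [this]; exact measurable_deriv F
  unfold gT
  refine (hasDerivAt_integral_of_dominated_loc_of_deriv_le
    (F := fun x z => F (x + z * σ)) (F' := fun x z => F' (x + z * σ))
    (bound := fun z => A * Real.exp (|x| + 1) * Real.exp (|σ| * |z|))
    (Metric.ball_mem_nhds x one_pos) ?_ ?_ ?_ ?_ ?_ ?_).2
  · exact Eventually.of_forall fun y => (hmF.comp (by fun_prop)).aestronglyMeasurable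
  · exact gT_integrable σ hmF hA x
  · exact (hmF'.comp (by fun_prop)).aestronglyMeasurable
  · refine Eventually.of_forall fun z y hy => ?_
    rw [Metric.mem_ball, Real.dist_eq] at hy
    have := exp_shift_bound σ x y z hy.le
    rw [Real.norm_eq_abs, mul_assoc]
    exact (hA' _).trans (by gcongr)
  · exact (integrable_exp_abs_gauss |σ|).const_mul _
  · refine Eventually.of_forall fun z y _ => ?_
    have h1 : HasDerivAt (fun y : ℝ => y + z * σ) 1 y := (hasDerivAt_id y).add_const _
    exact hda ((hF (y + z * σ)).comp y h1) (fun _ => rfl) (mul_one _).symm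

/-! ### The regularity class preserved by the recursion -/

/-- regularity class at level `m` -/
def Good (m : ℝ) (f : ℝ → ℝ) : Prop :=
  ∃ f1 f2 f3 : ℝ → ℝ, (∀ x, HasDerivAt f (f1 x) x) ∧ (∀ x, HasDerivAt f1 (f2 x) x) ∧
    (∀ x, HasDerivAt f2 (f3 x) x) ∧ (∀ x, |f1 x| ≤ 1) ∧
    (∀ x, |f2 x + m * f1 x ^ 2| ≤ 2 - m) ∧
    (∀ x, |f3 x + 3 * m * f1 x * f2 x + m ^ 2 * f1 x ^ 3| ≤ 1 + 11 * (1 - m))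

lemma abs_f2_le {m a b : ℝ} (hm0 : 0 ≤ m) (hm1 : m ≤ 1) (ha : |a| ≤ 1)
    (hb : |b + m * a ^ 2| ≤ 2 - m) : |b| ≤ 3 := by
  have ha2 : a ^ 2 ≤ 1 := (sq_le_one_iff_abs_le_one a).mpr ha
  have := sq_nonneg a
  rw [abs_le] at *
  constructor <;> nlinarith

lemma Good.mono {m m' : ℝ} (hm : 0 ≤ m) (hmm : m ≤ m') (hm' : m' ≤ 1) {f : ℝ → ℝ}
    (hf : Good m' f) : Good m f := by
  obtain ⟨f1, f2, f3, h1, h2, h3, b1, b2, b3⟩ := hf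
  refine ⟨f1, f2, f3, h1, h2, h3, b1, fun x => ?_, fun x => ?_⟩
  · have e : f2 x + m * f1 x ^ 2 = (f2 x + m' * f1 x ^ 2) - (m' - m) * f1 x ^ 2 := by ring
    have ha2 : f1 x ^ 2 ≤ 1 := (sq_le_one_iff_abs_le_one _).mpr (b1 x)
    rw [e]
    refine (abs_sub _ _).trans ?_
    have := b2 x
    rw [abs_mul, abs_of_nonneg (sub_nonneg.mpr hmm), abs_of_nonneg (sq_nonneg (f1 x))]
    nlinarith
  · have hb := abs_f2_le (hm.trans hmm) hm' (b1 x) (b2 x)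
    have e : f3 x + 3 * m * f1 x * f2 x + m ^ 2 * f1 x ^ 3
        = (f3 x + 3 * m' * f1 x * f2 x + m' ^ 2 * f1 x ^ 3)
          - (m' - m) * (3 * (f1 x * f2 x) + (m + m') * f1 x ^ 3) := by ring
    rw [e]
    refine (abs_sub _ _).trans ?_
    rw [abs_mul, abs_of_nonneg (sub_nonneg.mpr hmm)]
    have k1 : |f1 x * f2 x| ≤ 1 * 3 := by
      rw [abs_mul]; exact mul_le_mul (b1 x) hb (abs_nonneg _) zero_le_one
    have k2 : |f1 x ^ 3| ≤ 1 := by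
      rw [abs_pow]; exact pow_le_one₀ (abs_nonneg _) (b1 x)
    have k3 : |3 * (f1 x * f2 x) + (m + m') * f1 x ^ 3| ≤ 11 := by
      refine (abs_add_le _ _).trans ?_
      rw [abs_mul, abs_mul (m + m'), abs_of_nonneg (by linarith : 0 ≤ m + m'),
        abs_of_nonneg (by norm_num : (0:ℝ) ≤ 3)]
      have := abs_nonneg (f1 x ^ 3)
      nlinarith
    have := b3 x
    nlinarith

lemma abs_le_of_deriv_le_one {f f1 : ℝ → ℝ} (h1 : ∀ x, HasDerivAt f (f1 x) x)
    (b1 : ∀ x, |f1 x| ≤ 1) (x : ℝ) : |f x| ≤ |f 0| + |x| := by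
  have := Convex.norm_image_sub_le_of_norm_hasDerivWithin_le (f := f) (f' := f1) (C := 1)
    (s := univ) (x := 0) (y := x) (fun y _ => (h1 y).hasDerivWithinAt)
    (fun y _ => b1 y) convex_univ (mem_univ _) (mem_univ _)
  simp only [Real.norm_eq_abs, sub_zero, one_mul] at this
  have e : f x = f 0 + (f x - f 0) := by ring
  rw [e]; exact (abs_add_le _ _).trans (by gcongr)

lemma Good.step {m : ℝ} (hm0 : 0 ≤ m) (hm1 : m ≤ 1) {f : ℝ → ℝ} (hf : Good m f) (σ : ℝ) :
    Good m (fun x => if m = 0 then ∫ z, f (x + z * σ) ∂(gaussianReal 0 1)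
      else m⁻¹ * Real.log (∫ z, Real.exp (m * f (x + z * σ)) ∂(gaussianReal 0 1))) := by
  obtain ⟨f1, f2, f3, h1, h2, h3, b1, b2, b3⟩ := hf
  have mf : Measurable f :=
    (continuous_iff_continuousAt.mpr fun x => (h1 x).continuousAt).measurable
  have mf1 : Measurable f1 :=
    (continuous_iff_continuousAt.mpr fun x => (h2 x).continuousAt).measurable
  have mf2 : Measurable f2 :=
    (continuous_iff_continuousAt.mpr fun x => (h3 x).continuousAt).measurable
  have mf3 : Measurable f3 := by
    have : f3 = deriv f2 := funext fun x => (h3 x).deriv.symm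
    rw [this]; exact measurable_deriv f2
  have bf := abs_le_of_deriv_le_one h1 b1
  set U : ℝ → ℝ := fun x => Real.exp (m * f x) with hU
  have Upos : ∀ x, 0 < U x := fun x => Real.exp_pos _
  set A : ℝ := Real.exp |f 0| with hA
  have Apos : 0 < A := Real.exp_pos _
  have bU : ∀ x, |U x| ≤ A * Real.exp |x| := fun x => by
    rw [abs_of_pos (Upos x), hA, ← Real.exp_add]
    apply Real.exp_le_exp.mpr
    have := bf x
    have h4 := le_abs_self (f x)
    have h5 := abs_nonneg (f x)
    nlinarith
  have mU : Measurable U := (mf.const_mul m).exp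
  have dU : ∀ x, HasDerivAt U (m * (f1 x * U x)) x := fun x => by
    have := ((h1 x).const_mul m).exp
    refine hda this (fun _ => rfl) ?_
    simp only [hU]; ring
  -- weighted functions
  set a1 : ℝ → ℝ := fun x => f1 x * U x with ha1
  set a2 : ℝ → ℝ := fun x => (f2 x + m * f1 x ^ 2) * U x with ha2
  set a3 : ℝ → ℝ := fun x =>
    (f3 x + 3 * m * f1 x * f2 x + m ^ 2 * f1 x ^ 3) * U x with ha3
  have bw : ∀ (b : ℝ → ℝ) (c : ℝ), c ≤ 12 → (∀ x, |b x| ≤ c) → ∀ x,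
      |b x * U x| ≤ (12 * A) * Real.exp |x| := fun b c hc hb x => by
    rw [abs_mul, mul_assoc]
    exact mul_le_mul ((hb x).trans hc) (bU x) (abs_nonneg _) (by norm_num)
  have ba1 : ∀ x, |a1 x| ≤ (12 * A) * Real.exp |x| := bw f1 1 (by norm_num) b1
  have ba2 : ∀ x, |a2 x| ≤ (12 * A) * Real.exp |x| := bw _ (2 - m) (by linarith) b2
  have ba3 : ∀ x, |a3 x| ≤ (12 * A) * Real.exp |x| := bw _ (1 + 11 * (1 - m)) (by linarith) b3
  have bU' : ∀ x, |U x| ≤ (12 * A) * Real.exp |x| := fun x => by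
    have := bw (fun _ => 1) 1 (by norm_num) (fun x => by simp) x
    simpa using this
  have bma1 : ∀ x, |m * a1 x| ≤ (12 * A) * Real.exp |x| := fun x => by
    rw [abs_mul, abs_of_nonneg hm0]
    exact (mul_le_of_le_one_left (abs_nonneg _) hm1).trans (ba1 x)
  have da1 : ∀ x, HasDerivAt a1 (a2 x) x := fun x => by
    refine hda ((h2 x).mul (dU x)) (fun _ => rfl) ?_
    simp only [ha2]; ring
  have da2 : ∀ x, HasDerivAt a2 (a3 x) x := fun x => by
    refine hda (((h3 x).add (((h2 x).pow 2).const_mul m)).mul (dU x)) (fun _ => rfl) ?_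
    simp only [ha3, Pi.add_apply, Pi.pow_apply]; push_cast; ring
  have V0 := gT_hasDerivAt σ dU bU' bma1
  have V1 := gT_hasDerivAt σ da1 ba1 ba2
  have V2 := gT_hasDerivAt σ da2 ba2 ba3
  have Vm : ∀ x, gT σ (fun y => m * (f1 y * U y)) x = m * gT σ a1 x := fun x => by
    unfold gT; rw [integral_const_mul]
  have Vpos : ∀ x, 0 < gT σ U x := fun x => by
    unfold gT
    exact integral_exp_pos (gT_integrable σ mU bU x)
  have avg : ∀ (b : ℝ → ℝ) (c : ℝ), c ≤ 12 → (∀ x, |b x| ≤ c) → ∀ x,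
      |gT σ (fun y => b y * U y) x / gT σ U x| ≤ c := fun b c hc hb x => by
    rw [abs_div, abs_of_pos (Vpos x), div_le_iff₀ (Vpos x)]
    unfold gT
    rw [← integral_const_mul, ← Real.norm_eq_abs]
    refine norm_integral_le_of_norm_le ((gT_integrable σ mU bU x).const_mul c) ?_
    refine Eventually.of_forall fun z => ?_
    rw [Real.norm_eq_abs, abs_mul, abs_of_pos (Upos _)]
    exact mul_le_mul_of_nonneg_right (hb _) (Upos _).le
  set g1 : ℝ → ℝ := fun x => gT σ a1 x / gT σ U x with hg1
  set g2 : ℝ → ℝ := fun x => gT σ a2 x / gT σ U x - m * g1 x ^ 2 with hg2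
  set g3 : ℝ → ℝ := fun x => gT σ a3 x / gT σ U x
    - m * (gT σ a2 x / gT σ U x) * g1 x - 2 * m * g1 x * g2 x with hg3
  have dg1 : ∀ x, HasDerivAt g1 (g2 x) x := fun x => by
    have hne := (Vpos x).ne'
    refine hda ((V1 x).div (V0 x) hne) (fun _ => rfl) ?_
    rw [Vm]
    simp only [hg2, hg1]
    field_simp
  have dg2 : ∀ x, HasDerivAt g2 (g3 x) x := fun x => by
    have hne := (Vpos x).ne'
    refine hda (((V2 x).div (V0 x) hne).sub (((dg1 x).pow 2).const_mul m)) (fun _ => rfl) ?_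
    rw [Vm]
    simp only [hg3, hg1]
    push_cast
    field_simp
  refine ⟨g1, g2, g3, fun x => ?_, dg1, dg2, avg f1 1 (by norm_num) b1, fun x => ?_, fun x => ?_⟩
  · by_cases hm : m = 0
    · simp only [hm, if_true]
      have hU1 : U = fun _ => 1 := by funext y; simp [hU, hm]
      have e1 : g1 x = gT σ f1 x := by
        simp only [hg1, ha1, hU1]; simp [gT]
      rw [e1]
      refine gT_hasDerivAt σ (A := A + 1) h1 (fun y => ?_) (fun y => ?_) x
      · refine (bf y).trans ?_
        have k1 := Real.add_one_le_exp |f 0|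
        have k2 := Real.add_one_le_exp |y|
        have k3 := abs_nonneg (f 0)
        have k4 := abs_nonneg y
        rw [← hA] at k1
        nlinarith
      · refine (b1 y).trans ?_
        have k2 := Real.add_one_le_exp |y|
        have k4 := abs_nonneg y
        nlinarith
    · simp only [hm, if_false]
      have := ((V0 x).log (Vpos x).ne').const_mul m⁻¹
      refine hda this (fun _ => rfl) ?_
      rw [Vm]
      simp only [hg1]
      field_simp
  · have e : g2 x + m * g1 x ^ 2 = gT σ a2 x / gT σ U x := by simp only [hg2]; ring
    rw [e]
    exact avg _ (2 - m) (by linarith) b2 x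
  · have e : g3 x + 3 * m * g1 x * g2 x + m ^ 2 * g1 x ^ 3 = gT σ a3 x / gT σ U x := by
      simp only [hg3, hg2]; ring
    rw [e]
    exact avg _ (1 + 11 * (1 - m)) (by linarith) b3 x

lemma good_logcosh : Good 1 (fun x => Real.log (Real.cosh x)) := by
  have hc : ∀ x, Real.cosh x ≠ 0 := fun x => (Real.cosh_pos x).ne'
  have d2 : ∀ x, HasDerivAt (fun x => Real.sinh x / Real.cosh x)
      (1 - (Real.sinh x / Real.cosh x) ^ 2) x := fun x => by
    refine hda ((Real.hasDerivAt_sinh x).div (Real.hasDerivAt_cosh x) (hc x)) (fun _ => rfl) ?_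
    have := hc x
    field_simp
  have ht : ∀ x, |Real.sinh x / Real.cosh x| ≤ 1 := fun x => by
    rw [abs_div, abs_of_pos (Real.cosh_pos x), div_le_one (Real.cosh_pos x)]
    apply abs_le_of_sq_le_sq _ (Real.cosh_pos x).le
    have := Real.cosh_sq x
    linarith
  refine ⟨fun x => Real.sinh x / Real.cosh x, fun x => 1 - (Real.sinh x / Real.cosh x) ^ 2,
    fun x => - (2 * (Real.sinh x / Real.cosh x) * (1 - (Real.sinh x / Real.cosh x) ^ 2)),
    fun x => (Real.hasDerivAt_cosh x).log (hc x), d2, fun x => ?_, ht, fun x => ?_, fun x => ?_⟩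
  · refine hda (((d2 x).pow 2).const_sub 1) (fun _ => rfl) ?_
    push_cast; ring
  · norm_num
  · have e : ∀ t : ℝ, -(2 * t * (1 - t ^ 2)) + 3 * 1 * t * (1 - t ^ 2) + 1 ^ 2 * t ^ 3 = t :=
      fun t => by ring
    rw [e]; simpa using ht x

/-! ### Atomic solutions -/

lemma distF_nonneg (μ : Measure ℝ) (s : ℝ) : 0 ≤ distF μ s := ENNReal.toReal_nonneg

lemma distF_mono {μ : Measure ℝ} (hμ : MemM μ) : Monotone (distF μ) := by
  intro s t hst
  have := hμ.1
  exact ENNReal.toReal_mono (measure_ne_top _ _) (measure_mono (Icc_subset_Icc_right hst))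

lemma distF_le_one {μ : Measure ℝ} (hμ : MemM μ) (s : ℝ) : distF μ s ≤ 1 := by
  have := hμ.1
  exact ENNReal.toReal_le_of_le_ofReal zero_le_one (by simpa using prob_le_one)

lemma atomic_good {β : ℕ → ℝ} {μ : Measure ℝ} (hμ : MemM μ) (hfin : FinSupp μ)
    {Φ : ℝ → ℝ → ℝ} (hΦ : IsAtomicSol β μ Φ) :
    ∀ s ∈ Icc (0 : ℝ) 1, Good (distF μ s) (Φ s) := by
  obtain ⟨S, hS⟩ := hfin
  have hAt : ∀ q, μ {q} ≠ 0 → q ∈ S := by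
    intro q hq
    by_contra hqS
    exact hq (measure_mono_null (by simpa using hqS) hS)
  have hone : ∀ m, 0 ≤ m → m ≤ 1 → Good m (Φ 1) := by
    intro m hm0 hm1
    have : Φ 1 = fun x => Real.log (Real.cosh x) := funext hΦ.1
    rw [this]
    exact good_logcosh.mono hm0 hm1 le_rfl
  have key : ∀ n : ℕ, ∀ s ∈ Icc (0 : ℝ) 1, (S.filter (fun q => s < q)).card ≤ n →
      Good (distF μ s) (Φ s) := by
    intro n
    induction n using Nat.strong_induction_on with
    | _ n ih =>
    intro s hs hn
    rcases eq_or_lt_of_le hs.2 with h1 | h1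
    · rw [h1]; exact hone _ (distF_nonneg _ _) (distF_le_one hμ _)
    set t := nextPt μ s with ht
    have hfinT : ({q : ℝ | s < q ∧ q ≤ 1 ∧ μ {q} ≠ 0} ∪ {1}).Finite := by
      refine Set.Finite.union (S.finite_toSet.subset ?_) (finite_singleton 1)
      exact fun q hq => hAt q hq.2.2
    have hmem : t ∈ ({q : ℝ | s < q ∧ q ≤ 1 ∧ μ {q} ≠ 0} ∪ {1}) :=
      Set.Nonempty.csInf_mem ⟨1, Or.inr rfl⟩ hfinT
    have hg : Good (distF μ s) (Φ t) := by
      rcases hmem with h | h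
      · have hlt : (S.filter (fun q => t < q)).card < (S.filter (fun q => s < q)).card := by
          apply Finset.card_lt_card
          rw [Finset.ssubset_iff_of_subset]
          · exact ⟨t, by simp [hAt t h.2.2, h.1], by simp⟩
          · intro q hq
            simp only [Finset.mem_filter] at hq ⊢
            exact ⟨hq.1, h.1.trans hq.2⟩
        exact (ih _ (lt_of_lt_of_le hlt hn) t ⟨hs.1.trans h.1.le, h.2.1⟩ le_rfl).mono
          (distF_nonneg _ _) (distF_mono hμ h.1.le) (distF_le_one hμ _)
      · rw [mem_singleton_iff] at h
        rw [h]; exact hone _ (distF_nonneg _ _) (distF_le_one hμ _)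
    have e : Φ s = _ := funext (hΦ.2 s ⟨hs.1, h1⟩)
    rw [e]
    exact hg.step (distF_nonneg _ _) (distF_le_one hμ _) _
  exact fun s hs => key _ s hs le_rfl

/-! ### C² functions with Lipschitz second derivative -/

/-- `f` is C² with derivatives `f1`, `f2`, and `f2` is `C`-Lipschitz -/
def Reg (C : ℝ) (f f1 f2 : ℝ → ℝ) : Prop :=
  (∀ x, HasDerivAt f (f1 x) x) ∧ (∀ x, HasDerivAt f1 (f2 x) x) ∧
    ∀ x y, |f2 x - f2 y| ≤ C * |x - y|

lemma Good.reg {m : ℝ} (hm0 : 0 ≤ m) (hm1 : m ≤ 1) {f : ℝ → ℝ} (hf : Good m f) :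
    ∃ f1 f2, Reg 30 f f1 f2 := by
  obtain ⟨f1, f2, f3, h1, h2, h3, b1, b2, b3⟩ := hf
  refine ⟨f1, f2, h1, h2, fun x y => ?_⟩
  have hb : ∀ x, ‖f3 x‖ ≤ 30 := by
    intro x
    have hb := abs_f2_le hm0 hm1 (b1 x) (b2 x)
    have e : f3 x = (f3 x + 3 * m * f1 x * f2 x + m ^ 2 * f1 x ^ 3)
        - m * (3 * (f1 x * f2 x) + m * f1 x ^ 3) := by ring
    rw [Real.norm_eq_abs, e]
    refine (abs_sub _ _).trans ?_
    rw [abs_mul, abs_of_nonneg hm0]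
    have k1 : |f1 x * f2 x| ≤ 1 * 3 := by
      rw [abs_mul]; exact mul_le_mul (b1 x) hb (abs_nonneg _) zero_le_one
    have k2 : |f1 x ^ 3| ≤ 1 := by
      rw [abs_pow]; exact pow_le_one₀ (abs_nonneg _) (b1 x)
    have k3 : |3 * (f1 x * f2 x) + m * f1 x ^ 3| ≤ 11 := by
      refine (abs_add_le _ _).trans ?_
      rw [abs_mul, abs_mul m, abs_of_nonneg hm0, abs_of_nonneg (by norm_num : (0:ℝ) ≤ 3)]
      have := abs_nonneg (f1 x ^ 3)
      nlinarith
    have := b3 x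
    nlinarith
  exact Convex.norm_image_sub_le_of_norm_hasDerivWithin_le (f := f2) (f' := f3) (C := 30)
    (s := univ) (x := y) (y := x) (fun y _ => (h3 y).hasDerivWithinAt)
    (fun y _ => hb y) convex_univ (mem_univ _) (mem_univ _)

lemma Reg.sub {C : ℝ} {f f1 f2 g g1 g2 : ℝ → ℝ} (hf : Reg C f f1 f2) (hg : Reg C g g1 g2) :
    Reg (2 * C) (fun x => f x - g x) (fun x => f1 x - g1 x) (fun x => f2 x - g2 x) := by
  refine ⟨fun x => (hf.1 x).sub (hg.1 x), fun x => (hf.2.1 x).sub (hg.2.1 x), fun x y => ?_⟩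
  have e : f2 x - g2 x - (f2 y - g2 y) = (f2 x - f2 y) - (g2 x - g2 y) := by ring
  rw [e]
  refine (abs_sub _ _).trans ?_
  linarith [hf.2.2 x y, hg.2.2 x y]

lemma Reg.taylor {C : ℝ} (hC : 0 ≤ C) {f f1 f2 : ℝ → ℝ} (hf : Reg C f f1 f2) {h : ℝ}
    (hh : 0 ≤ h) (x y : ℝ) (hy : y ∈ Icc (-h) h) :
    |f (x + y) - f x - y * f1 x - y ^ 2 / 2 * f2 x| ≤ C * h ^ 3 := by
  have hs : ∀ y : ℝ, HasDerivAt (fun y : ℝ => x + y) 1 y := fun y =>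
    (hasDerivAt_id y).const_add x
  have h0 : (0 : ℝ) ∈ Icc (-h) h := ⟨by linarith, hh⟩
  have s1 : ∀ y ∈ Icc (-h) h, |f1 (x + y) - f1 x - y * f2 x| ≤ C * h ^ 2 := by
    intro y hy
    have := Convex.norm_image_sub_le_of_norm_hasDerivWithin_le
      (f := fun y => f1 (x + y) - f1 x - y * f2 x) (f' := fun y => f2 (x + y) - f2 x)
      (C := C * h) (s := Icc (-h) h) (x := 0) (y := y)
      (fun y _ => by
        have a := (hf.2.1 (x + y)).comp y (hs y)
        have b := (a.sub_const (f1 x)).sub ((hasDerivAt_id y).mul_const (f2 x))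
        exact (hda b (fun _ => rfl) (by simp)).hasDerivWithinAt)
      (fun y hy => by
        have := hf.2.2 (x + y) x
        simp only [add_sub_cancel_left] at this
        exact this.trans (mul_le_mul_of_nonneg_left (abs_le.mpr hy) hC))
      (convex_Icc _ _) h0 hy
    simp only [Real.norm_eq_abs, add_zero, sub_self, zero_mul, sub_zero] at this
    refine this.trans ?_
    have hy' := abs_le.mpr hy
    have : C * h * |y| ≤ C * h * h := by gcongr
    nlinarith
  have := Convex.norm_image_sub_le_of_norm_hasDerivWithin_le
    (f := fun y => f (x + y) - f x - y * f1 x - y ^ 2 / 2 * f2 x)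
    (f' := fun y => f1 (x + y) - f1 x - y * f2 x)
    (C := C * h ^ 2) (s := Icc (-h) h) (x := 0) (y := y)
    (fun y _ => by
      have a := (hf.1 (x + y)).comp y (hs y)
      have b := ((a.sub_const (f x)).sub ((hasDerivAt_id y).mul_const (f1 x))).sub
        ((((hasDerivAt_id y).pow 2).div_const 2).mul_const (f2 x))
      refine HasDerivAt.hasDerivWithinAt ?_
      refine hda b (fun _ => rfl) ?_
      simp only [id]; push_cast; ring)
    (fun y hy => s1 y hy)
    (convex_Icc _ _) h0 hy
  simp only [Real.norm_eq_abs, add_zero, sub_self, zero_mul, sub_zero] at this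
  norm_num at this
  refine this.trans ?_
  have hy' := abs_le.mpr hy
  have : C * h ^ 2 * |y| ≤ C * h ^ 2 * h := by gcongr
  nlinarith

lemma landau {C : ℝ} (hC : 0 < C) {η : ℝ} (hη : 0 < η) : ∃ ε : ℝ, 0 < ε ∧ ε ≤ η ∧
    ∀ f f1 f2 : ℝ → ℝ, Reg C f f1 f2 → (∀ x, |f x| ≤ ε) →
      ∀ x, |f1 x| ≤ η ∧ |f2 x| ≤ η := by
  obtain ⟨h, hh, hh1, hCh⟩ : ∃ h : ℝ, 0 < h ∧ h ≤ 1 ∧ 4 * C * h ≤ η := by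
    refine ⟨min 1 (η / (4 * C)), by positivity, min_le_left _ _, ?_⟩
    calc 4 * C * min 1 (η / (4 * C)) ≤ 4 * C * (η / (4 * C)) := by
          gcongr; exact min_le_right _ _
      _ = η := by field_simp
  refine ⟨η * h ^ 2 / 8, by positivity, ?_, fun f f1 f2 hf hb x => ?_⟩
  · have : h ^ 2 ≤ 1 := pow_le_one₀ hh.le hh1
    nlinarith
  have tp := hf.taylor hC.le hh.le x h ⟨by linarith, le_rfl⟩
  have tm := hf.taylor hC.le hh.le x (-h) ⟨le_rfl, by linarith⟩
  have b0 := hb x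
  have bp := hb (x + h)
  have bm := hb (x + -h)
  have hC2 : C * h ^ 3 ≤ η * h ^ 2 / 4 := by
    have : C * h ^ 3 = (4 * C * h) * h ^ 2 / 4 := by ring
    rw [this]; gcongr
  have hhh : η * h ^ 2 ≤ η * h := by nlinarith [mul_pos hη hh]
  have h2pos : 0 < h ^ 2 := by positivity
  rw [abs_le] at *
  obtain ⟨tp1, tp2⟩ := tp
  obtain ⟨tm1, tm2⟩ := tm
  obtain ⟨b01, b02⟩ := b0
  obtain ⟨bp1, bp2⟩ := bp
  obtain ⟨bm1, bm2⟩ := bm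
  have e2 : (-h) ^ 2 = h ^ 2 := by ring
  rw [e2] at tm1 tm2
  refine ⟨⟨?_, ?_⟩, abs_le.mpr ⟨?_, ?_⟩⟩
  · refine le_of_mul_le_mul_left (?_ : h * (-η) ≤ h * f1 x) hh
    linarith
  · refine le_of_mul_le_mul_left (?_ : h * f1 x ≤ h * η) hh
    linarith
  · refine le_of_mul_le_mul_left (?_ : h ^ 2 * (-η) ≤ h ^ 2 * f2 x) h2pos
    linarith
  · refine le_of_mul_le_mul_left (?_ : h ^ 2 * f2 x ≤ h ^ 2 * η) h2pos
    linarith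

lemma reg_closed {C : ℝ} (hC : 0 < C) {f : ℝ → ℝ}
    (H : ∀ ε : ℝ, 0 < ε → ∃ g g1 g2, Reg C g g1 g2 ∧ ∀ x, |f x - g x| ≤ ε) :
    ∃ f1 f2, Reg C f f1 f2 := by
  have hpos : ∀ n : ℕ, (0 : ℝ) < 1 / ((n : ℝ) + 1) := fun n => by positivity
  choose g g1 g2 hg hfg using fun n : ℕ => H _ (hpos n)
  have lim0 := tendsto_one_div_add_atTop_nhds_zero_nat (𝕜 := ℝ)
  have hgf : TendstoUniformly g f atTop := by
    rw [Metric.tendstoUniformly_iff]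
    intro ε hε
    filter_upwards [lim0.eventually_lt_const hε] with n hn x
    rw [Real.dist_eq]
    exact (hfg n x).trans_lt hn
  have cau : ∀ η : ℝ, 0 < η → ∃ N, ∀ n ≥ N, ∀ k ≥ N, ∀ x,
      |g1 n x - g1 k x| ≤ η ∧ |g2 n x - g2 k x| ≤ η := by
    intro η hη
    obtain ⟨ε, hε, -, hL⟩ := landau (C := 2 * C) (by positivity) hη
    obtain ⟨N, hN⟩ := eventually_atTop.mp (lim0.eventually_lt_const (half_pos hε))
    refine ⟨N, fun n hn k hk => hL _ _ _ ((hg n).sub (hg k)) fun x => ?_⟩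
    have e : g n x - g k x = (f x - g k x) - (f x - g n x) := by ring
    rw [e]
    refine (abs_sub _ _).trans ?_
    linarith [hfg n x, hfg k x, hN n hn, hN k hk]
  have mk : ∀ G : ℕ → ℝ → ℝ, (∀ η : ℝ, 0 < η → ∃ N, ∀ n ≥ N, ∀ k ≥ N, ∀ x,
      |G n x - G k x| ≤ η) → ∃ L : ℝ → ℝ, TendstoUniformly G L atTop := by
    intro G hG
    have hc : ∀ x, CauchySeq fun n => G n x := fun x => by
      rw [Metric.cauchySeq_iff]
      intro ε hε
      obtain ⟨N, hN⟩ := hG (ε / 2) (half_pos hε)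
      exact ⟨N, fun n hn k hk => by
        rw [Real.dist_eq]; exact (hN n hn k hk x).trans_lt (half_lt_self hε)⟩
    choose L hL using fun x => cauchySeq_tendsto_of_complete (hc x)
    refine ⟨L, ?_⟩
    rw [Metric.tendstoUniformly_iff]
    intro ε hε
    obtain ⟨N, hN⟩ := hG (ε / 2) (half_pos hε)
    filter_upwards [eventually_ge_atTop N] with n hn x
    rw [Real.dist_eq]
    refine lt_of_le_of_lt ?_ (half_lt_self hε)
    refine le_of_tendsto ((hL x).sub_const (G n x)).abs ?_
    filter_upwards [eventually_ge_atTop N] with k hk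
    exact hN k hk n hn x
  obtain ⟨f1, hf1⟩ := mk g1 fun η hη => by
    obtain ⟨N, hN⟩ := cau η hη
    exact ⟨N, fun n hn k hk x => (hN n hn k hk x).1⟩
  obtain ⟨f2, hf2⟩ := mk g2 fun η hη => by
    obtain ⟨N, hN⟩ := cau η hη
    exact ⟨N, fun n hn k hk x => (hN n hn k hk x).2⟩
  refine ⟨f1, f2, fun x => ?_, fun x => ?_, fun x y => ?_⟩
  · exact hasDerivAt_of_tendstoUniformly hf1
      (Eventually.of_forall fun n x => (hg n).1 x) (fun x => hgf.tendsto_at x) x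
  · exact hasDerivAt_of_tendstoUniformly hf2
      (Eventually.of_forall fun n x => (hg n).2.1 x) (fun x => hf1.tendsto_at x) x
  · exact le_of_tendsto ((hf2.tendsto_at x).sub (hf2.tendsto_at y)).abs
      (Eventually.of_forall fun n => (hg n).2.2 x y)

/-! ### Weak convergence and the metric -/

lemma distF_eq_Iic {μ : Measure ℝ} (hμ : MemM μ) (s : ℝ) : distF μ s = (μ (Iic s)).toReal := by
  unfold distF
  congr 1
  refine le_antisymm (measure_mono Icc_subset_Iic_self) ?_
  calc μ (Iic s) ≤ μ (Icc 0 s ∪ (Icc (0:ℝ) 1)ᶜ) := by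
        refine measure_mono fun x hx => ?_
        by_cases h : x ∈ Icc (0:ℝ) 1
        · exact Or.inl ⟨h.1, hx⟩
        · exact Or.inr h
    _ ≤ μ (Icc 0 s) + μ (Icc (0:ℝ) 1)ᶜ := measure_union_le _ _
    _ = μ (Icc 0 s) := by rw [hμ.2, add_zero]

lemma dM_tendsto {μs : ℕ → Measure ℝ} (hμs : ∀ n, MemM (μs n)) {μ : Measure ℝ} (hμ : MemM μ)
    (hweak : ∀ f : BoundedContinuousFunction ℝ ℝ,
      Filter.Tendsto (fun n => ∫ x, f x ∂(μs n)) Filter.atTop (nhds (∫ x, f x ∂μ))) :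
    Tendsto (fun n => dM μ (μs n)) atTop (nhds 0) := by
  have := hμ.1
  have := fun n => (hμs n).1
  let P : ProbabilityMeasure ℝ := ⟨μ, hμ.1⟩
  let Ps : ℕ → ProbabilityMeasure ℝ := fun n => ⟨μs n, (hμs n).1⟩
  have hP : Tendsto Ps atTop (nhds P) := by
    rw [ProbabilityMeasure.tendsto_iff_forall_integral_tendsto]
    exact hweak
  have hpt : ∀ s, μ {s} = 0 → Tendsto (fun n => distF (μs n) s) atTop (nhds (distF μ s)) := by
    intro s hs
    simp only [distF_eq_Iic hμ, distF_eq_Iic (hμs _)]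
    refine (ENNReal.tendsto_toReal (measure_ne_top _ _)).comp ?_
    exact ProbabilityMeasure.tendsto_measure_of_null_frontier_of_tendsto' (μ := P) (μs := Ps) hP
      (E := Iic s) (by rw [frontier_Iic]; exact hs)
  have hae : ∀ᵐ s : ℝ, μ {s} = 0 := by
    have hcount : {s : ℝ | 0 < μ {s}}.Countable := by
      exact Measure.countable_meas_pos_of_disjoint_iUnion (fun s => measurableSet_singleton s)
        (fun a b hab => by simpa using hab)
    have := hcount.ae_notMem volume
    filter_upwards [this] with s hs
    simpa using hs
  have hmeas : ∀ ν, MemM ν → Measurable (distF ν) := fun ν hν => (distF_mono hν).measurable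
  have := intervalIntegral.tendsto_integral_filter_of_dominated_convergence (a := 0) (b := 1)
    (μ := volume) (l := atTop) (F := fun n s => |distF μ s - distF (μs n) s|)
    (f := fun _ => (0 : ℝ)) (fun _ => 2)
    (Eventually.of_forall fun n =>
      ((hmeas μ hμ).sub (hmeas _ (hμs n))).abs.aestronglyMeasurable)
    (Eventually.of_forall fun n => Eventually.of_forall fun s _ => by
      rw [Real.norm_eq_abs, abs_abs]
      refine (abs_sub _ _).trans ?_
      rw [abs_of_nonneg (distF_nonneg _ _), abs_of_nonneg (distF_nonneg _ _)]
      linarith [distF_le_one hμ s, distF_le_one (hμs n) s])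
    (by simp)
    (by
      filter_upwards [hae] with s hs _
      have := ((hpt s hs).const_sub (distF μ s)).abs
      simpa using this)
  simpa [dM] using this

/-- rounding map -/
def rnd (n : ℕ) (x : ℝ) : ℝ := (⌈((n : ℝ) + 1) * x⌉ : ℝ) / ((n : ℝ) + 1)

lemma rnd_measurable (n : ℕ) : Measurable (rnd n) := by
  unfold rnd
  have : Measurable fun x : ℝ => ((⌈((n : ℝ) + 1) * x⌉ : ℤ) : ℝ) :=
    (measurable_from_top (f := fun k : ℤ => (k : ℝ))).comp
      (Int.measurable_ceil.comp (measurable_const_mul _))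
  exact this.div_const _

lemma rnd_bounds (n : ℕ) (x : ℝ) : x ≤ rnd n x ∧ rnd n x ≤ x + 1 / ((n : ℝ) + 1) := by
  have hn : (0 : ℝ) < (n : ℝ) + 1 := by positivity
  unfold rnd
  constructor
  · rw [le_div_iff₀ hn, mul_comm]; exact Int.le_ceil _
  · have e : (x + 1 / ((n : ℝ) + 1)) * ((n : ℝ) + 1) = ((n : ℝ) + 1) * x + 1 := by field_simp
    rw [div_le_iff₀ hn, e]
    exact (Int.ceil_lt_add_one _).le

lemma rnd_tendsto (x : ℝ) : Tendsto (fun n => rnd n x) atTop (nhds x) := by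
  refine tendsto_of_tendsto_of_tendsto_of_le_of_le tendsto_const_nhds
    (h := fun n : ℕ => x + 1 / ((n : ℝ) + 1)) ?_
    (fun n => (rnd_bounds n x).1) (fun n => (rnd_bounds n x).2)
  simpa using (tendsto_one_div_add_atTop_nhds_zero_nat (𝕜 := ℝ)).const_add x

lemma rnd_memM {μ : Measure ℝ} (hμ : MemM μ) (n : ℕ) :
    MemM (μ.map (rnd n)) ∧ FinSupp (μ.map (rnd n)) := by
  have := hμ.1
  have hn : (0 : ℝ) < (n : ℝ) + 1 := by positivity
  have hk : ∀ x ∈ Icc (0:ℝ) 1, ∃ k : ℕ, k < n + 2 ∧ rnd n x = (k : ℝ) / ((n : ℝ) + 1) := by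
    intro x hx
    have h0 : 0 ≤ ⌈((n : ℝ) + 1) * x⌉ := Int.ceil_nonneg (mul_nonneg hn.le hx.1)
    have h1 : ⌈((n : ℝ) + 1) * x⌉ ≤ (n : ℤ) + 1 := by
      apply Int.ceil_le.mpr
      push_cast
      nlinarith [hx.2]
    refine ⟨⌈((n : ℝ) + 1) * x⌉.toNat, by omega, ?_⟩
    unfold rnd
    congr 1
    have : ((⌈((n : ℝ) + 1) * x⌉.toNat : ℤ) : ℝ) = (⌈((n : ℝ) + 1) * x⌉ : ℝ) := by
      rw [Int.toNat_of_nonneg h0]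
    rw [← this]; norm_cast
  refine ⟨⟨Measure.isProbabilityMeasure_map (rnd_measurable n).aemeasurable, ?_⟩, ?_⟩
  · rw [Measure.map_apply (rnd_measurable n) measurableSet_Icc.compl]
    refine measure_mono_null (t := (Icc (0:ℝ) 1)ᶜ) (fun x hx hx' => hx ?_) hμ.2
    obtain ⟨k, hk1, hk2⟩ := hk x hx'
    rw [hk2]
    refine ⟨by positivity, ?_⟩
    rw [div_le_one hn]
    exact_mod_cast Nat.lt_succ_iff.mp hk1
  · classical
    refine ⟨(Finset.range (n + 2)).image (fun k : ℕ => (k : ℝ) / ((n : ℝ) + 1)), ?_⟩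
    rw [Measure.map_apply (rnd_measurable n) (Finset.measurableSet _).compl]
    refine measure_mono_null (t := (Icc (0:ℝ) 1)ᶜ) (fun x hx hx' => hx ?_) hμ.2
    obtain ⟨k, hk1, hk2⟩ := hk x hx'
    rw [hk2]
    simp only [Finset.coe_image, Finset.coe_range]
    exact ⟨k, hk1, rfl⟩

lemma exists_atomic {μ : Measure ℝ} (hμ : MemM μ) {δ : ℝ} (hδ : 0 < δ) :
    ∃ ν, MemM ν ∧ FinSupp ν ∧ dM μ ν < δ := by
  have := hμ.1
  have := dM_tendsto (μs := fun n => μ.map (rnd n)) (fun n => (rnd_memM hμ n).1) hμ (fun f => by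
    have e : ∀ n, ∫ x, f x ∂(μ.map (rnd n)) = ∫ x, f (rnd n x) ∂μ := fun n =>
      integral_map (rnd_measurable n).aemeasurable f.continuous.aestronglyMeasurable
    simp only [e]
    refine tendsto_integral_of_dominated_convergence (fun _ => ‖f‖) (fun n => ?_)
      (integrable_const _) (fun n => Eventually.of_forall fun x => f.norm_coe_le_norm _)
      (Eventually.of_forall fun x => (f.continuous.tendsto x).comp (rnd_tendsto x))
    exact (f.continuous.measurable.comp (rnd_measurable n)).aestronglyMeasurable)
  obtain ⟨n, hn⟩ := (this.eventually_lt_const hδ).exists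
  exact ⟨_, (rnd_memM hμ n).1, (rnd_memM hμ n).2, hn⟩

lemma parisi_reg {β : ℕ → ℝ} {Φ : Measure ℝ → ℝ → ℝ → ℝ} (hΦ : IsParisiFamily β Φ)
    {μ : Measure ℝ} (hμ : MemM μ) {s : ℝ} (hs : s ∈ Icc (0 : ℝ) 1) :
    ∃ f1 f2, Reg 30 (Φ μ s) f1 f2 := by
  refine reg_closed (by norm_num) fun ε hε => ?_
  obtain ⟨δ, hδ, h⟩ := hΦ.2 μ hμ ε hε
  obtain ⟨ν, hν, hνf, hd⟩ := exists_atomic hμ hδ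
  obtain ⟨g1, g2, hg⟩ := (atomic_good hν hνf (hΦ.1 ν hν hνf) s hs).reg
    (distF_nonneg _ _) (distF_le_one hν _)
  exact ⟨Φ ν s, g1, g2, hg, fun x => (h ν hν hd s hs x).le⟩

/-- **Proposition 2(iv).** If `μ_n → μ` weakly in `𝓜`, then for `j = 0, 1, 2`,
`∂ₓʲ Φ_{μ_n} → ∂ₓʲ Φ_μ` uniformly on `[0,1] × ℝ`. -/
theorem stmt12 (β : ℕ → ℝ) (hβ : ValidBeta β)
    (Φ : Measure ℝ → ℝ → ℝ → ℝ) (hΦ : IsParisiFamily β Φ)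
    (μs : ℕ → Measure ℝ) (hμs : ∀ n, MemM (μs n))
    (μ : Measure ℝ) (hμ : MemM μ)
    (hweak : ∀ f : BoundedContinuousFunction ℝ ℝ,
      Filter.Tendsto (fun n => ∫ x, f x ∂(μs n)) Filter.atTop (nhds (∫ x, f x ∂μ))) :
    ∀ j : ℕ, j ≤ 2 →
      TendstoUniformlyOn
        (fun n (p : ℝ × ℝ) => iteratedDeriv j (Φ (μs n) p.1) p.2)
        (fun p : ℝ × ℝ => iteratedDeriv j (Φ μ p.1) p.2)
        Filter.atTop (Icc (0 : ℝ) 1 ×ˢ (univ : Set ℝ)) := by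
  intro j hj
  rw [Metric.tendstoUniformlyOn_iff]
  intro η hη
  obtain ⟨ε, hε, hεη, hL⟩ := landau (C := 2 * 30) (by norm_num) (half_pos hη)
  obtain ⟨δ, hδ, hc⟩ := hΦ.2 μ hμ ε hε
  filter_upwards [(dM_tendsto hμs hμ hweak).eventually_lt_const hδ] with n hn p hp
  obtain ⟨s, x⟩ := p
  have hs : s ∈ Icc (0 : ℝ) 1 := hp.1
  obtain ⟨f1, f2, hf⟩ := parisi_reg hΦ hμ hs
  obtain ⟨g1, g2, hg⟩ := parisi_reg hΦ (hμs n) hs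
  have hclose := hc (μs n) (hμs n) hn s hs
  have hLx := hL _ _ _ (hf.sub hg) (fun x => (hclose x).le) x
  have ef1 : deriv (Φ μ s) = f1 := funext fun x => (hf.1 x).deriv
  have eg1 : deriv (Φ (μs n) s) = g1 := funext fun x => (hg.1 x).deriv
  have ef2 : deriv f1 = f2 := funext fun x => (hf.2.1 x).deriv
  have eg2 : deriv g1 = g2 := funext fun x => (hg.2.1 x).deriv
  rw [Real.dist_eq]
  interval_cases j
  · simp only [iteratedDeriv_zero]
    linarith [hclose x]
  · simp only [iteratedDeriv_one, ef1, eg1]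
    linarith [hLx.1]
  · simp only [iteratedDeriv_succ, iteratedDeriv_zero, ef1, eg1, ef2, eg2]
    linarith [hLx.2]

end
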